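/- arXiv:2407.14660 — 4 statements merged into one kernel-verified Lean document; each statement's English description precedes it below -/
import Mathlib

section
/- For any affine subspace A of F_{2^n} not containing 0, which is a coset of a linear subspace E, the sum of the multiplicative inverses of the elements of A equals (∏_{0≠u∈E} u) / (∏_{u∈A} u); in particular this sum is nonzero. -/
open scoped Classical

noncomputable instance (n : ℕ) : Fintype (GaloisField 2 n) := Fintype.ofFinite _

/-- For an affine subspace `A = v + E` of `F_{2^n}` not containing `0`, the sum of the
inverses over `A` equals `(∏_{0 ≠ u ∈ E} u) / (∏_{u ∈ A} u)`, and in particular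
this sum is nonzero. -/
theorem sum_inv_coset_eq_and_ne_zero (n : ℕ) (hn : 0 < n)
    (E : Submodule (ZMod 2) (GaloisField 2 n)) (v : GaloisField 2 n)
    (h0 : ∀ x ∈ E, v + x ≠ 0) :
    (∑ x ∈ Finset.univ.filter (fun x => x ∈ E), (v + x)⁻¹)
      = (∏ u ∈ Finset.univ.filter (fun u => u ∈ E ∧ u ≠ 0), u)
        / (∏ x ∈ Finset.univ.filter (fun x => x ∈ E), (v + x)) ∧
    (∑ x ∈ Finset.univ.filter (fun x => x ∈ E), (v + x)⁻¹) ≠ 0 := by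
  set S : Finset (GaloisField 2 n) := Finset.univ.filter (fun x => x ∈ E) with hS
  have mS : ∀ x, x ∈ S ↔ x ∈ E := fun x => by simp [hS]
  have hT : Finset.univ.filter (fun u => u ∈ E ∧ u ≠ 0) = S.erase 0 := by
    ext x
    simp [mS, and_comm]
  rw [hT]
  have hP : ∏ x ∈ S, (v + x) ≠ 0 :=
    Finset.prod_ne_zero_iff.2 fun x hx => h0 x ((mS x).1 hx)
  have hc : ∏ u ∈ S.erase 0, u ≠ 0 :=
    Finset.prod_ne_zero_iff.2 fun x hx => (Finset.mem_erase.1 hx).1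
  have hshift : ∀ i ∈ S, ∏ j ∈ S.erase i, (i + j) = ∏ u ∈ S.erase 0, u := by
    intro i hi
    have hiE := (mS i).1 hi
    refine Finset.prod_bij' (fun j _ => i + j) (fun j _ => i + j) ?_ ?_ ?_ ?_ ?_
    · intro j hj
      rw [Finset.mem_erase, mS] at hj ⊢
      exact ⟨fun h => hj.1 (CharTwo.add_eq_zero.1 h).symm, E.add_mem hiE hj.2⟩
    · intro j hj
      rw [Finset.mem_erase, mS] at hj ⊢
      exact ⟨fun h => hj.1 (by simpa using h), E.add_mem hiE hj.2⟩
    · intro j _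
      simp [← add_assoc, CharTwo.add_self_eq_zero]
    · intro j _
      simp [← add_assoc, CharTwo.add_self_eq_zero]
    · intro j _
      rfl
  have hne : S.Nonempty := ⟨0, (mS 0).2 E.zero_mem⟩
  have hL := congrArg (Polynomial.eval v)
    (Lagrange.sum_basis (s := S) (v := id) (Set.injOn_id _) hne)
  have hterm : ∀ i ∈ S, Polynomial.eval v (Lagrange.basis S id i)
      = (∏ x ∈ S, (v + x)) * (∏ u ∈ S.erase 0, u)⁻¹ * (v + i)⁻¹ := by
    intro i hi
    have hvi := h0 i ((mS i).1 hi)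
    rw [← hshift i hi, ← Finset.mul_prod_erase S _ hi, Lagrange.basis, Polynomial.eval_prod]
    simp only [Lagrange.basisDivisor, id, Polynomial.eval_mul, Polynomial.eval_C,
      Polynomial.eval_add, Polynomial.eval_X, CharTwo.sub_eq_add, Finset.prod_mul_distrib,
      Finset.prod_inv_distrib]
    field_simp
  rw [Polynomial.eval_finsetSum, Finset.sum_congr rfl hterm, ← Finset.mul_sum,
    Polynomial.eval_one] at hL
  have key : ∑ x ∈ S, (v + x)⁻¹ = (∏ u ∈ S.erase 0, u) / ∏ x ∈ S, (v + x) := by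
    rw [eq_div_iff hP]
    field_simp at hL
    rw [mul_comm]
    simpa using hL
  exact ⟨key, key ▸ div_ne_zero hc hP⟩
end

section
/- If X^n − 1 ∈ F_2[X] has a monic factor f of degree k with zero coefficient of X, then there exists x ∈ F_{2^n} such that x, x^2, …, x^{2^{k−1}} are F_2-linearly independent while x, x^4, x^8, …, x^{2^k} are F_2-linearly dependent. Conversely, the existence of such x implies X^n − 1 has such a factor. -/
open Polynomial

/-- The Frobenius map as an `F_2`-linear endomorphism. -/
noncomputable def frobL (n : ℕ) : Module.End (ZMod 2) (GaloisField 2 n) :=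
  (FiniteField.frobeniusAlgHom (ZMod 2) (GaloisField 2 n)).toLinearMap

theorem frobL_pow (n i : ℕ) (x : GaloisField 2 n) : (frobL n ^ i) x = x ^ 2 ^ i := by
  induction i with
  | zero => simp
  | succ i ih =>
    rw [pow_succ', Module.End.mul_apply, ih]
    simp [frobL, ZMod.card, pow_succ, pow_mul, pow_two]

theorem linInd_iff (n k : ℕ) (e : Fin k → ℕ) (he : Function.Injective e) (x : GaloisField 2 n) :
    LinearIndependent (ZMod 2) (fun i : Fin k => x ^ 2 ^ e i) ↔
      ∀ p : (ZMod 2)[X], (∀ j, j ∉ Set.range e → p.coeff j = 0) →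
        aeval (frobL n) p x = 0 → p = 0 := by
  have key : ∀ g : Fin k → ZMod 2, aeval (frobL n) (∑ i, C (g i) * X ^ e i) x
      = ∑ i, g i • x ^ 2 ^ e i := by
    intro g
    simp only [map_sum, map_mul, aeval_C, map_pow, aeval_X, LinearMap.sum_apply,
      Module.End.mul_apply, frobL_pow, Module.algebraMap_end_apply]
  have hc : ∀ (g : Fin k → ZMod 2) i, (∑ i, C (g i) * X ^ e i).coeff (e i) = g i := by
    intro g i
    simp [finsetSum_coeff, coeff_X_pow, he.eq_iff]
  have hc' : ∀ (g : Fin k → ZMod 2) j, j ∉ Set.range e →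
      (∑ i, C (g i) * X ^ e i).coeff j = 0 := by
    intro g j hj
    simp only [finsetSum_coeff, coeff_C_mul, coeff_X_pow]
    refine Finset.sum_eq_zero fun i _ => ?_
    rw [if_neg (fun h => hj ⟨i, h.symm⟩), mul_zero]
  rw [Fintype.linearIndependent_iff]
  constructor
  · intro h p hp hx
    have hpe : p = ∑ i, C (p.coeff (e i)) * X ^ e i := by
      ext j
      by_cases hj : j ∈ Set.range e
      · obtain ⟨i, rfl⟩ := hj
        rw [hc (fun i => p.coeff (e i))]
      · rw [hp j hj, hc' (fun i => p.coeff (e i)) j hj]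
    rw [hpe, key (fun i => p.coeff (e i))] at hx
    have := h _ hx
    rw [hpe]
    exact Finset.sum_eq_zero fun i _ => by rw [this i]; simp
  · intro h g hg i
    have := h (∑ i, C (g i) * X ^ e i) (hc' g) (by rw [key, hg])
    rw [← hc g i, this, coeff_zero]

theorem linInd_iff_lt (n k : ℕ) (x : GaloisField 2 n) :
    LinearIndependent (ZMod 2) (fun i : Fin k => x ^ 2 ^ (i : ℕ)) ↔
      ∀ p : (ZMod 2)[X], p.degree < k → aeval (frobL n) p x = 0 → p = 0 := by
  rw [linInd_iff n k (fun i => (i : ℕ)) Fin.val_injective]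
  refine forall_congr' fun p => imp_congr ?_ Iff.rfl
  rw [degree_lt_iff_coeff_zero]
  refine forall_congr' fun j => imp_congr ?_ Iff.rfl
  simp [Fin.exists_iff]

theorem exists_normal (n : ℕ) (hn : n ≠ 0) : ∃ a : GaloisField 2 n,
    LinearIndependent (ZMod 2) (fun i : Fin n => a ^ 2 ^ (i : ℕ)) := by
  obtain ⟨a, ha⟩ := exists_linearIndependent_algEquiv_apply (ZMod 2) (GaloisField 2 n)
  refine ⟨a, ?_⟩
  have h1 := ha.comp _
    (FiniteField.bijective_frobeniusAlgEquivOfAlgebraic_pow (ZMod 2) (GaloisField 2 n)).1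
  have h2 := h1.comp _ (finCongr (GaloisField.finrank 2 hn).symm).injective
  convert h2 using 2 with i
  simp [AlgEquiv.coe_pow, FiniteField.coe_frobeniusAlgEquivOfAlgebraic_iterate, ZMod.card]

theorem aeval_frob_X_pow (n : ℕ) (hn : n ≠ 0) (x : GaloisField 2 n) :
    aeval (frobL n) (X ^ n - 1 : (ZMod 2)[X]) x = 0 := by
  have : Fintype (GaloisField 2 n) := Fintype.ofFinite _
  have h := FiniteField.pow_card x
  rw [← Nat.card_eq_fintype_card, GaloisField.card 2 n hn] at h
  simp [frobL_pow, h]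


/-- `X^n - 1 ∈ F_2[X]` has a monic degree-`k` factor with zero coefficient of `X` iff
there exists `x ∈ F_{2^n}` such that `x, x^2, …, x^(2^(k-1))` are `F_2`-linearly
independent while `x, x^4, x^8, …, x^(2^k)` are `F_2`-linearly dependent. -/
theorem exists_factor_iff_exists_elem (n k : ℕ) (hk : 2 ≤ k) (hkn : k ≤ n - 1) :
    (∃ f : (ZMod 2)[X], f.Monic ∧ f.natDegree = k ∧ f.coeff 1 = 0 ∧
        f ∣ (X ^ n - 1 : (ZMod 2)[X])) ↔
      ∃ x : GaloisField 2 n,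
        LinearIndependent (ZMod 2) (fun i : Fin k => x ^ 2 ^ (i : ℕ)) ∧
        ¬ LinearIndependent (ZMod 2)
            (fun i : Fin k => x ^ 2 ^ (if (i : ℕ) = 0 then 0 else (i : ℕ) + 1)) := by
  have hn : n ≠ 0 := by omega
  have he : Function.Injective (fun i : Fin k => if (i : ℕ) = 0 then 0 else (i : ℕ) + 1) := by
    intro i j h
    ext
    dsimp only at h
    split_ifs at h <;> omega
  have hr : ∀ j, j ∉ Set.range (fun i : Fin k => if (i : ℕ) = 0 then 0 else (i : ℕ) + 1) ↔
      (j = 1 ∨ k < j) := by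
    intro j
    rw [← not_iff_not, not_not]
    constructor
    · rintro ⟨i, rfl⟩
      have := i.2
      dsimp only
      split_ifs <;> first | omega | simp
    · intro h
      by_cases hj : j = 0
      · exact ⟨⟨0, by omega⟩, by simp [hj]⟩
      · refine ⟨⟨j - 1, by omega⟩, ?_⟩
        dsimp only
        split_ifs <;> omega
  simp only [linInd_iff n k _ he, hr, linInd_iff_lt]
  constructor
  · rintro ⟨f, hm, hd, h1, g, hg⟩
    obtain ⟨a, ha⟩ := exists_normal n hn
    rw [linInd_iff_lt] at ha
    have hne : (X ^ n - 1 : (ZMod 2)[X]) ≠ 0 := X_pow_sub_C_ne_zero (Nat.pos_of_ne_zero hn) 1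
    have hg0 : g ≠ 0 := by
      rintro rfl
      exact hne (by rw [hg, mul_zero])
    have hdeg : (n : WithBot ℕ) = (k : WithBot ℕ) + g.degree := by
      have := congrArg degree hg
      rw [degree_mul, degree_eq_natDegree hm.ne_zero, hd] at this
      rw [← this]
      exact (degree_X_pow_sub_C (Nat.pos_of_ne_zero hn) (1 : ZMod 2)).symm
    refine ⟨aeval (frobL n) g a, ?_, ?_⟩
    · intro p hp h0
      rw [← Module.End.mul_apply, ← map_mul] at h0
      have := ha (p * g) (by
        rw [degree_mul, hdeg, degree_eq_natDegree hg0]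
        exact WithBot.add_lt_add_right (by simp) hp) h0
      exact (mul_eq_zero.1 this).resolve_right hg0
    · intro h
      refine hm.ne_zero (h f ?_ ?_)
      · rintro j (rfl | hj)
        · exact h1
        · exact coeff_eq_zero_of_natDegree_lt (by omega)
      · rw [← Module.End.mul_apply, ← map_mul, ← hg, aeval_frob_X_pow n hn]
  · rintro ⟨x, hx, hnx⟩
    push Not at hnx
    obtain ⟨f, hf, hfx, hf0⟩ := hnx
    have hle : f.natDegree ≤ k := natDegree_le_iff_coeff_eq_zero.2 fun j hj => hf j (Or.inr hj)
    have hd : f.natDegree = k := by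
      refine le_antisymm hle (not_lt.1 fun hlt => hf0 (hx f ?_ hfx))
      rw [degree_eq_natDegree hf0]
      exact_mod_cast hlt
    have hm : f.Monic := by
      have h2 : ∀ z : ZMod 2, z ≠ 0 → z = 1 := by decide
      exact h2 _ (leadingCoeff_ne_zero.2 hf0)
    refine ⟨f, hm, hd, hf 1 (Or.inl rfl), ?_⟩
    rw [← modByMonic_eq_zero_iff_dvd hm]
    apply hx
    · have := degree_modByMonic_lt (X ^ n - 1 : (ZMod 2)[X]) hm
      rwa [degree_eq_natDegree hf0, hd] at this
    · rw [modByMonic_eq_sub_mul_div, map_sub, LinearMap.sub_apply, aeval_frob_X_pow n hn,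
        mul_comm, map_mul, Module.End.mul_apply, hfx, map_zero, sub_zero]
end

section
/- Writing F_k(X_1,…,X_k) = C_{k−1}X_1^{2^{k−1}} + ⋯ + C_0 X_1 + C_{−1} with C_i ∈ F_2[X_2,…,X_k], one has C_{k−1} = F_{k−1}(X_2,…,X_k), C_i = F_{k−1}(X_2,…,X_k)·Δ_i(X_2,…,X_k)/Δ(X_2,…,X_k) for 0 ≤ i ≤ k−2, and C_{−1} = Δ(X_2,…,X_k)^2. -/
open MvPolynomial

namespace FkAux

open Matrix

/-- Three-term Pluecker relation. -/
lemma pluecker {R : Type*} [CommRing R] {m : ℕ} (a b c w : Fin (m + 2) → R)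
    (S : Fin m → Fin (m + 2) → R) :
    det (of (Fin.cons a (Fin.cons b S) : Fin (m + 2) → Fin (m + 2) → R)) *
      det (of (Fin.cons c (Fin.cons w S) : Fin (m + 2) → Fin (m + 2) → R)) =
    det (of (Fin.cons w (Fin.cons b S) : Fin (m + 2) → Fin (m + 2) → R)) *
      det (of (Fin.cons c (Fin.cons a S) : Fin (m + 2) → Fin (m + 2) → R)) +
    det (of (Fin.cons a (Fin.cons w S) : Fin (m + 2) → Fin (m + 2) → R)) *
      det (of (Fin.cons c (Fin.cons b S) : Fin (m + 2) → Fin (m + 2) → R)) := by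
  set M : Matrix (Fin (m + 2)) (Fin (m + 2)) R := of (Fin.cons a (Fin.cons b S)) with hM
  have hL : ∀ v, cramer (of (Fin.cons c (Fin.cons b S) : Fin (m + 2) → Fin (m + 2) → R))ᵀ v 1 =
      det (of (Fin.cons c (Fin.cons v S) : Fin (m + 2) → Fin (m + 2) → R)) := by
    intro v
    rw [cramer_transpose_apply]
    congr 1
    ext i j
    refine Fin.cases ?_ (fun i => Fin.cases ?_ (fun i => ?_) i) i
    · simp [updateRow_apply]
    · simp [updateRow_apply]
    · simp [updateRow_apply, Fin.ext_iff]
  have h0 : cramer Mᵀ w 0 = det (of (Fin.cons w (Fin.cons b S) : Fin (m + 2) → Fin (m + 2) → R)) := by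
    rw [cramer_transpose_apply]
    congr 1
    ext i j
    refine Fin.cases ?_ (fun i => ?_) i
    · simp [updateRow_apply]
    · simp [updateRow_apply, hM]
  have h1 : cramer Mᵀ w 1 = det (of (Fin.cons a (Fin.cons w S) : Fin (m + 2) → Fin (m + 2) → R)) := by
    rw [cramer_transpose_apply]
    congr 1
    ext i j
    refine Fin.cases ?_ (fun i => Fin.cases ?_ (fun i => ?_) i) i
    · simp [updateRow_apply, hM]
    · simp [updateRow_apply, hM]
    · simp [updateRow_apply, Fin.ext_iff, hM]
  have hw : M.det • w = ∑ i, cramer Mᵀ w i • M i := by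
    have := mulVec_cramer Mᵀ w
    rw [det_transpose] at this
    rw [← this]
    ext j
    simp [mulVec, dotProduct, mul_comm]
  have key := congrArg (fun v =>
    cramer (of (Fin.cons c (Fin.cons b S) : Fin (m + 2) → Fin (m + 2) → R))ᵀ v 1) hw
  simp only [map_smul, map_sum, Pi.smul_apply, Finset.sum_apply, smul_eq_mul] at key
  simp only [hL] at key
  rw [key, Fin.sum_univ_succ, Fin.sum_univ_succ, Finset.sum_eq_zero]
  · rw [h0, Fin.succ_zero_eq_one, h1, add_zero]
    rfl
  · intro i _
    apply mul_eq_zero_of_right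
    refine det_zero_of_row_eq (i := 1) (j := i.succ.succ) (by simp [Fin.ext_iff]) ?_
    ext j
    simp [hM]

lemma det_perm {R : Type*} [CommRing R] [CharP R 2] {n : ℕ} (σ : Equiv.Perm (Fin n))
    (M : Matrix (Fin n) (Fin n) R) : (M.submatrix σ id).det = M.det := by
  rw [det_permute]
  rcases Int.units_eq_one_or (Equiv.Perm.sign σ) with h | h <;> simp [h, CharTwo.neg_eq]

lemma det_swap {R : Type*} [CommRing R] [CharP R 2] {m : ℕ} (a w : Fin (m + 2) → R)
    (S : Fin m → Fin (m + 2) → R) :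
    det (of (Fin.cons a (Fin.cons w S) : Fin (m + 2) → Fin (m + 2) → R)) =
    det (of (Fin.cons w (Fin.cons a S) : Fin (m + 2) → Fin (m + 2) → R)) := by
  rw [← det_perm (Equiv.swap 0 1)]
  congr 1
  ext i j
  refine Fin.cases ?_ (fun i => Fin.cases ?_ (fun i => ?_) i) i
  · simp
  · simp
  · simp [Equiv.swap_apply_of_ne_of_ne, Fin.ext_iff]

lemma det_snoc {R : Type*} [CommRing R] [CharP R 2] {m : ℕ} (a w : Fin (m + 2) → R)
    (S : Fin m → Fin (m + 2) → R) :
    det (of (Fin.cons a (Fin.snoc S w : Fin (m + 1) → _) : Fin (m + 2) → Fin (m + 2) → R)) =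
    det (of (Fin.cons a (Fin.cons w S) : Fin (m + 2) → Fin (m + 2) → R)) := by
  rw [Fin.cons_snoc_eq_snoc_cons, Fin.snoc_eq_cons_rotate, det_swap a w]
  exact det_perm (finRotate _) (of (Fin.cons w (Fin.cons a S)))

lemma det_e0 {R : Type*} [CommRing R] {n : ℕ} (B : Fin n → Fin (n + 1) → R) :
    det (of (Fin.cons (Pi.single 0 1) B : Fin (n + 1) → Fin (n + 1) → R)) =
      det (of fun i j : Fin n => B i j.succ) := by
  rw [det_succ_row_zero, Fin.sum_univ_succ, Finset.sum_eq_zero]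
  · simp
    congr 1
  · intro i _
    simp

lemma moore_ne_zero (n : ℕ) : det (of fun i j : Fin n =>
    (X j : MvPolynomial (Fin n) (ZMod 2)) ^ 2 ^ (i : ℕ)) ≠ 0 := by
  have h1 : det (of fun i j : Fin n => (X j : MvPolynomial (Fin n) (ZMod 2)) ^ 2 ^ (i : ℕ)) =
      ∑ σ : Equiv.Perm (Fin n),
        monomial (∑ j : Fin n, Finsupp.single j (2 ^ (σ j : ℕ))) (1 : ZMod 2) := by
    rw [det_apply]
    refine Finset.sum_congr rfl fun σ _ => ?_
    rw [monomial_sum_one]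
    rcases Int.units_eq_one_or (Equiv.Perm.sign σ) with h | h <;>
      simp [h, CharTwo.neg_eq, X_pow_eq_monomial]
  intro h
  have := congrArg (coeff (∑ j : Fin n, Finsupp.single j (2 ^ (j : ℕ)))) h
  rw [h1, coeff_sum, Finset.sum_eq_single 1] at this
  · simp at this
  · intro σ _ hσ
    rw [coeff_monomial, if_neg]
    intro hs
    apply hσ
    ext i
    have := DFunLike.congr_fun hs i
    simpa [Finsupp.finsetSum_apply, Finsupp.single_apply] using this
  · simp

lemma expand {R : Type*} [CommRing R] [CharP R 2] {k : ℕ} (x : Fin (k + 1) → R) :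
    det (of fun i j : Fin (k + 1) => x j ^ 2 ^ (i : ℕ)) =
    det (of fun i j : Fin k => x j.succ ^ 2 ^ (i : ℕ)) * x 0 ^ 2 ^ k +
    ∑ i ∈ Finset.range k, det (of fun l j : Fin k => x j.succ ^
                  2 ^ (if (l : ℕ) < i then (l : ℕ) else (l : ℕ) + 1)) * x 0 ^ 2 ^ i := by
  have h1 : det (of fun i j : Fin k => x j.succ ^ 2 ^ (i : ℕ)) =
     det (of fun l j : Fin k => x j.succ ^
                  2 ^ (if (l : ℕ) < k then (l : ℕ) else (l : ℕ) + 1)) := by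
    simp
  rw [h1, add_comm (_ * _) (Finset.sum _ _), ← Finset.sum_range_succ (fun i => det (of fun l j : Fin k => x j.succ ^
                  2 ^ (if (l : ℕ) < i then (l : ℕ) else (l : ℕ) + 1)) * x 0 ^ 2 ^ i),
    Finset.sum_range, det_succ_column_zero]
  refine Finset.sum_congr rfl fun i _ => ?_
  rw [CharTwo.neg_eq (1 : R), one_pow, one_mul, mul_comm]
  congr 1
  congr 1
  ext l j
  simp only [submatrix_apply, of_apply, Fin.succAbove]
  congr 2
  by_cases h : (l : ℕ) < i <;> simp [h, Fin.lt_def]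

lemma main {R : Type*} [CommRing R] [CharP R 2] {m : ℕ} (x : Fin (m + 2) → R) :
    det (of fun i j : Fin (m + 1) => x j.succ ^ 2 ^ (i : ℕ)) ^ 2 *
      det (of fun i j : Fin (m + 2) => x j ^ 2 ^ (if (i : ℕ) = 0 then 0 else (i : ℕ) + 1)) =
    det (of fun i j : Fin (m + 1) => x j.succ ^ 2 ^ (if (i : ℕ) = 0 then 0 else (i : ℕ) + 1)) *
      det (of fun i j : Fin (m + 2) => x j ^ 2 ^ (i : ℕ)) ^ 2 +
    det (of fun i j : Fin (m + 1) => x j.succ ^ 2 ^ (i : ℕ)) ^ 4 *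
      det (of fun i j : Fin (m + 2) => x j ^ 2 ^ (i : ℕ)) := by
  have hsq : ∀ {n : ℕ} (y : Fin n → R), det (of fun i j : Fin n => y j ^ 2 ^ (i : ℕ)) ^ 2 =
      det (of fun i j : Fin n => y j ^ 2 ^ ((i : ℕ) + 1)) := by
    intro n y
    rw [← frobenius_def, RingHom.map_det]
    congr 1
    ext i j
    simp [frobenius_def, pow_succ, pow_mul]
  have hq : ∀ {n : ℕ} (y : Fin n → R), det (of fun i j : Fin n => y j ^ 2 ^ (i : ℕ)) ^ 4 =
      det (of fun i j : Fin n => y j ^ 2 ^ ((i : ℕ) + 2)) := by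
    intro n y
    rw [show 4 = 2 * 2 from rfl, pow_mul, hsq, ← frobenius_def, RingHom.map_det]
    congr 1
    ext i j
    simp [frobenius_def, pow_succ, pow_mul]
  let r : ℕ → Fin (m + 2) → R := fun e j => x j ^ 2 ^ e
  let S : Fin m → Fin (m + 2) → R := fun i => r (i + 2)
  have hS : (fun i : Fin (m + 1) => r (i + 2)) = (Fin.snoc S (r (m + 2)) : Fin (m + 1) → _) := by
    ext i j
    refine Fin.lastCases ?_ (fun i => ?_) i <;> simp [S]
  have e1 : det (of fun i j : Fin (m + 2) => x j ^ 2 ^ (if (i : ℕ) = 0 then 0 else (i : ℕ) + 1)) =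
      det (of (Fin.cons (r 0) (Fin.cons (r (m + 2)) S) : Fin (m + 2) → Fin (m + 2) → R)) := by
    rw [← det_snoc, ← hS]
    congr 1
    ext i j
    refine Fin.cases ?_ (fun i => ?_) i <;> simp [r]
  have e2 : det (of fun i j : Fin (m + 2) => x j ^ 2 ^ (i : ℕ)) ^ 2 =
      det (of (Fin.cons (r 1) (Fin.cons (r (m + 2)) S) : Fin (m + 2) → Fin (m + 2) → R)) := by
    rw [hsq, ← det_snoc, ← hS]
    congr 1
    ext i j
    refine Fin.cases ?_ (fun i => ?_) i <;> simp [r]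
  have e3 : det (of fun i j : Fin (m + 2) => x j ^ 2 ^ (i : ℕ)) =
      det (of (Fin.cons (r 0) (Fin.cons (r 1) S) : Fin (m + 2) → Fin (m + 2) → R)) := by
    congr 1
    ext i j
    refine Fin.cases ?_ (fun i => Fin.cases ?_ (fun i => ?_) i) i <;> simp [r, S]
  have e4 : det (of fun i j : Fin (m + 1) => x j.succ ^ 2 ^ (i : ℕ)) ^ 2 =
      det (of (Fin.cons (Pi.single 0 1) (Fin.cons (r 1) S) :
        Fin (m + 2) → Fin (m + 2) → R)) := by
    rw [hsq (fun j : Fin (m + 1) => x j.succ), det_e0]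
    congr 1
    ext i j
    refine Fin.cases ?_ (fun i => ?_) i <;> simp [r, S]
  have e5 : det (of fun i j : Fin (m + 1) => x j.succ ^ 2 ^ (i : ℕ)) ^ 4 =
      det (of (Fin.cons (Pi.single 0 1) (Fin.cons (r (m + 2)) S) :
        Fin (m + 2) → Fin (m + 2) → R)) := by
    rw [hq (fun j : Fin (m + 1) => x j.succ), ← det_snoc, ← hS, det_e0]
  have e6 : det (of fun i j : Fin (m + 1) => x j.succ ^
        2 ^ (if (i : ℕ) = 0 then 0 else (i : ℕ) + 1)) =
      det (of (Fin.cons (Pi.single 0 1) (Fin.cons (r 0) S) :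
        Fin (m + 2) → Fin (m + 2) → R)) := by
    rw [det_e0]
    congr 1
    ext i j
    refine Fin.cases ?_ (fun i => ?_) i <;> simp [r, S]
  rw [e1, e2, e4, e5, e6, e3, pluecker]
  rw [det_swap (r (m + 2)) (r 1), det_swap (r 0) (Pi.single 0 1)]
  ring

end FkAux


/-- Writing `F_{k+1}(X_1,…,X_{k+1}) = C_k X_1^(2^k) + ⋯ + C_0 X_1 + C_{-1}` with
`C_i ∈ F_2[X_2,…,X_{k+1}]`, one has `C_k = F_k(X_2,…,X_{k+1})`,
`C_i = F_k(X_2,…,X_{k+1}) · Δ_i(X_2,…,X_{k+1}) / Δ(X_2,…,X_{k+1})` for `0 ≤ i ≤ k-1`,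
and `C_{-1} = Δ(X_2,…,X_{k+1})^2`. Equivalently (multiplying through by
`Δ(X_2,…,X_{k+1})`), the polynomial identity below holds, where `F_{k+1}` and `F_k` are
characterized by `Δ · F = Δ_1` in `k+1` resp. `k` variables, and the `k`-variable
determinants are renamed into `F_2[X_1,…,X_{k+1}]` via `Fin.succ`. -/
theorem Fk_coefficients (k : ℕ) (hk : 2 ≤ k)
    (Fk1 : MvPolynomial (Fin (k + 1)) (ZMod 2)) (Fk : MvPolynomial (Fin k) (ZMod 2))
    (hFk1 : Matrix.det (Matrix.of fun i j : Fin (k + 1) =>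
          (X j : MvPolynomial (Fin (k + 1)) (ZMod 2)) ^ 2 ^ (i : ℕ)) * Fk1 =
        Matrix.det (Matrix.of fun i j : Fin (k + 1) =>
          (X j : MvPolynomial (Fin (k + 1)) (ZMod 2)) ^
            2 ^ (if (i : ℕ) = 0 then 0 else (i : ℕ) + 1)))
    (hFk : Matrix.det (Matrix.of fun i j : Fin k =>
          (X j : MvPolynomial (Fin k) (ZMod 2)) ^ 2 ^ (i : ℕ)) * Fk =
        Matrix.det (Matrix.of fun i j : Fin k =>
          (X j : MvPolynomial (Fin k) (ZMod 2)) ^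
            2 ^ (if (i : ℕ) = 0 then 0 else (i : ℕ) + 1))) :
    (rename Fin.succ (Matrix.det (Matrix.of fun i j : Fin k =>
          (X j : MvPolynomial (Fin k) (ZMod 2)) ^ 2 ^ (i : ℕ)))) * Fk1 =
      (rename Fin.succ (Matrix.det (Matrix.of fun i j : Fin k =>
            (X j : MvPolynomial (Fin k) (ZMod 2)) ^ 2 ^ (i : ℕ)))) *
          (rename Fin.succ Fk) * (X 0) ^ 2 ^ k +
        (rename Fin.succ Fk) *
          (∑ i ∈ Finset.range k,
            (rename Fin.succ (Matrix.det (Matrix.of fun l j : Fin k =>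
                (X j : MvPolynomial (Fin k) (ZMod 2)) ^
                  2 ^ (if (l : ℕ) < i then (l : ℕ) else (l : ℕ) + 1)))) *
              (X 0) ^ 2 ^ i) +
        (rename Fin.succ (Matrix.det (Matrix.of fun i j : Fin k =>
            (X j : MvPolynomial (Fin k) (ZMod 2)) ^ 2 ^ (i : ℕ)))) ^ 3 := by
  obtain ⟨m, rfl⟩ : ∃ m, k = m + 1 := ⟨k - 1, by omega⟩
  have hren : ∀ e : Fin (m + 1) → ℕ, rename Fin.succ (Matrix.det (Matrix.of fun i j : Fin (m + 1) =>
      (X j : MvPolynomial (Fin (m + 1)) (ZMod 2)) ^ 2 ^ (e i))) =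
      Matrix.det (Matrix.of fun i j : Fin (m + 1) =>
      (X j.succ : MvPolynomial (Fin (m + 2)) (ZMod 2)) ^ 2 ^ (e i)) := by
    intro e
    rw [AlgHom.map_det]
    congr 1
    ext1 i j
    simp
  have hD : rename Fin.succ (Matrix.det (Matrix.of fun i j : Fin (m + 1) =>
      (X j : MvPolynomial (Fin (m + 1)) (ZMod 2)) ^ 2 ^ (i : ℕ))) ≠ 0 := by
    rw [Ne, map_eq_zero_iff _ (rename_injective _ (Fin.succ_injective _))]
    exact FkAux.moore_ne_zero _
  have hE := FkAux.moore_ne_zero (m + 2)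
  have hf := congrArg (rename Fin.succ) hFk
  rw [map_mul] at hf
  have hmain := FkAux.main (fun j => (X j : MvPolynomial (Fin (m + 2)) (ZMod 2)))
  have hexp := FkAux.expand (k := m + 1) (fun j => (X j : MvPolynomial (Fin (m + 2)) (ZMod 2)))
  simp only [hren] at hf hD ⊢
  rw [← hFk1, ← hf] at hmain
  set D := Matrix.det (Matrix.of fun i j : Fin (m + 1) =>
      (X j.succ : MvPolynomial (Fin (m + 2)) (ZMod 2)) ^ 2 ^ (i : ℕ))
  set E := Matrix.det (Matrix.of fun i j : Fin (m + 2) =>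
      (X j : MvPolynomial (Fin (m + 2)) (ZMod 2)) ^ 2 ^ (i : ℕ))
  apply mul_left_cancel₀ (mul_ne_zero hD hE)
  rw [mul_comm D (rename Fin.succ Fk), mul_assoc (rename Fin.succ Fk), ← mul_add, ← hexp]
  linear_combination hmain
end

section
/- For k ≥ 3, the polynomial F_k(X_1,…,X_k) = Δ_1(X_1,…,X_k)/Δ(X_1,…,X_k) is absolutely irreducible, i.e., irreducible over the algebraic closure of F_2. -/
open MvPolynomial
section FkAux
theorem inv_const {R A : Type*} [CommRing R] [IsDomain R] [AddCommGroup A] [Fintype A]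
    (w : A →+ R) (hw : Function.Injective w) (Q : Polynomial R)
    (hQ : ∀ a, Polynomial.taylor (w a) Q = Q) (hd : Q.natDegree < Fintype.card A) :
    Q = Polynomial.C (Q.coeff 0) := by
  have h0 : Q - Polynomial.C (Q.coeff 0) = 0 := by
    refine Polynomial.eq_zero_of_natDegree_lt_card_of_eval_eq_zero _ hw ?_ ?_
    · intro a
      have : Polynomial.eval 0 (Polynomial.taylor (w a) Q) = Polynomial.eval 0 Q := by rw [hQ]
      rw [Polynomial.taylor_eval, zero_add] at this
      rw [Polynomial.eval_sub, this, Polynomial.eval_C, Polynomial.coeff_zero_eq_eval_zero, sub_self]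
    · rwa [Polynomial.natDegree_sub_C]
  exact sub_eq_zero.mp h0

theorem irr_abstract {R A : Type*} [CommRing R] [IsDomain R] [UniqueFactorizationMonoid R]
    [AddCommGroup A] [Fintype A] (w : A →+ R) (hw : Function.Injective w) (n : ℕ)
    (hA : Fintype.card A = 2 ^ n) (G : Polynomial R) (hdeg : G.natDegree = 2 ^ n)
    (hG : ∀ a, Polynomial.taylor (w a) G = G)
    (hprim : ∀ p : R, Prime p → Polynomial.C p ∣ G → False)
    (hlead : ∀ c a : R, IsUnit c → G.leadingCoeff ≠ a ^ 2 * c) : Irreducible G := by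
  classical
  have hG0 : G ≠ 0 := by
    rintro rfl
    simp at hdeg
    exact (pow_ne_zero n two_ne_zero) hdeg.symm
  have hGu : ¬ IsUnit G := fun h => by
    have := Polynomial.natDegree_eq_zero_of_isUnit h
    rw [hdeg] at this
    exact (pow_ne_zero n two_ne_zero) this
  obtain ⟨P, hP, hPG⟩ := WfDvdMonoid.exists_irreducible_factor hGu hG0
  have hPp : Prime P := hP.prime
  have hPd : P.natDegree ≠ 0 := by
    intro h
    rw [Polynomial.eq_C_of_natDegree_eq_zero h] at hPp hPG
    exact hprim _ (Polynomial.prime_C_iff.mp hPp) hPG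
  let act : AddAction A (Polynomial R) :=
    { vadd := fun a p => Polynomial.taylor (w a) p
      zero_vadd := fun p => by
        change Polynomial.taylor (w 0) p = p
        rw [map_zero, Polynomial.taylor_zero]
      add_vadd := fun a b p => by
        change Polynomial.taylor (w (a + b)) p = Polynomial.taylor (w a) (Polynomial.taylor (w b) p)
        rw [Polynomial.taylor_taylor, map_add, add_comm] }
  have hact : ∀ (a : A) (p : Polynomial R), a +ᵥ p = Polynomial.taylor (w a) p := fun _ _ => rfl
  have hfin : (AddAction.orbit A P).Finite := Set.finite_range _
  set O : Finset (Polynomial R) := hfin.toFinset with hO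
  have hOmem : ∀ q, q ∈ O ↔ ∃ a, Polynomial.taylor (w a) P = q := by
    intro q
    rw [hO, Set.Finite.mem_toFinset]
    rfl
  have hcard : O.card ∣ 2 ^ n := by
    have : Fintype (AddAction.orbit A P) := hfin.fintype
    have : Fintype (AddAction.stabilizer A P) := Fintype.ofFinite _
    have h1 := AddAction.card_orbit_mul_card_stabilizer_eq_card_addGroup A P
    rw [← hA, ← h1]
    have : O.card = Fintype.card (AddAction.orbit A P) := by
      rw [hO, Set.Finite.card_toFinset]
    rw [this]
    exact dvd_mul_right _ _
  have htd : ∀ a (p q : Polynomial R), p ∣ q → Polynomial.taylor (w a) p ∣ Polynomial.taylor (w a) q := by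
    rintro a p q ⟨r, rfl⟩
    rw [Polynomial.taylor_mul]; exact dvd_mul_right _ _
  have hlc : ∀ q ∈ O, q.leadingCoeff = P.leadingCoeff := by
    intro q hq
    obtain ⟨a, rfl⟩ := (hOmem q).1 hq
    exact Polynomial.leadingCoeff_taylor _ _
  have hpr : ∀ q ∈ O, Prime q := by
    intro q hq
    obtain ⟨a, rfl⟩ := (hOmem q).1 hq
    exact (MulEquiv.prime_iff (Polynomial.taylorEquiv (w a))).2 hPp
  have hQG : (∏ q ∈ O, q) ∣ G := by
    refine Finset.prod_dvd_of_isRelPrime ?_ ?_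
    · intro q hq r hr hqr
      refine (hpr q hq).irreducible.isRelPrime_iff_not_dvd.2 ?_
      intro hd
      apply hqr
      obtain ⟨c, hc⟩ := hd
      change r = q * c at hc
      have hcu : IsUnit c := ((hpr r hr).irreducible.isUnit_or_isUnit hc).resolve_left (hpr q hq).not_isUnit
      obtain ⟨d, hd, rfl⟩ := Polynomial.isUnit_iff.1 hcu
      have h1 := congrArg Polynomial.leadingCoeff hc
      rw [Polynomial.leadingCoeff_mul, hlc q hq, hlc r hr, Polynomial.leadingCoeff_C] at h1
      have h2 : d = 1 := by
        have h3 : P.leadingCoeff ≠ 0 := Polynomial.leadingCoeff_ne_zero.2 hPp.ne_zero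
        exact mul_left_cancel₀ h3 (by rw [← h1, mul_one])
      rw [hc, h2, map_one, mul_one]
    · intro q hq
      obtain ⟨a, rfl⟩ := (hOmem q).1 hq
      have := htd a _ _ hPG
      rwa [hG] at this
  have hQinv : ∀ a, Polynomial.taylor (w a) (∏ q ∈ O, q) = ∏ q ∈ O, q := by
    intro a
    have h1 : Polynomial.taylor (w a) (∏ q ∈ O, q) = ∏ q ∈ O, Polynomial.taylor (w a) q :=
      map_prod (Polynomial.taylorAlgHom (w a)) _ _
    rw [h1]
    refine Finset.prod_bij (fun q _ => Polynomial.taylor (w a) q) ?_ ?_ ?_ ?_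
    · intro q hq
      obtain ⟨b, rfl⟩ := (hOmem q).1 hq
      refine (hOmem _).2 ⟨a + b, ?_⟩
      rw [Polynomial.taylor_taylor, map_add, add_comm]
    · intro q _ r _ h
      exact Polynomial.taylor_injective _ h
    · intro q hq
      obtain ⟨b, rfl⟩ := (hOmem q).1 hq
      refine ⟨Polynomial.taylor (w (b - a)) P, (hOmem _).2 ⟨_, rfl⟩, ?_⟩
      rw [Polynomial.taylor_taylor, ← map_add]
      simp
    · intros; rfl
  have hPO : P ∈ O := (hOmem P).2 ⟨0, by rw [map_zero, Polynomial.taylor_zero]⟩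
  have hQ0 : (∏ q ∈ O, q) ≠ 0 := Finset.prod_ne_zero_iff.2 fun q hq => (hpr q hq).ne_zero
  have hQd : 2 ^ n ≤ (∏ q ∈ O, q).natDegree := by
    by_contra hlt
    rw [not_le, ← hA] at hlt
    have h1 := inv_const w hw _ hQinv hlt
    have h2 : P.natDegree ≤ (∏ q ∈ O, q).natDegree :=
      Polynomial.natDegree_le_of_dvd (Finset.dvd_prod_of_mem _ hPO) hQ0
    rw [h1, Polynomial.natDegree_C] at h2
    omega
  obtain ⟨c, hc⟩ := hQG
  have hc0 : c ≠ 0 := by rintro rfl; exact hG0 (by rw [hc, mul_zero])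
  have hcd : c.natDegree = 0 := by
    have := Polynomial.natDegree_mul hQ0 hc0
    rw [← hc] at this
    omega
  rw [Polynomial.eq_C_of_natDegree_eq_zero hcd] at hc hc0
  set cc := c.coeff 0
  have hcc0 : cc ≠ 0 := by intro h; rw [h] at hc0; simp at hc0
  have hcu : IsUnit cc := by
    by_contra hcu
    obtain ⟨p, hp, hpc⟩ := WfDvdMonoid.exists_irreducible_factor hcu hcc0
    refine hprim p hp.prime ?_
    rw [hc]
    exact dvd_mul_of_dvd_right (map_dvd Polynomial.C hpc) _
  have hl : G.leadingCoeff = P.leadingCoeff ^ O.card * cc := by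
    rw [hc, Polynomial.leadingCoeff_mul, Polynomial.leadingCoeff_C, Polynomial.leadingCoeff_prod,
      Finset.prod_congr rfl hlc, Finset.prod_const]
  obtain ⟨m, -, hm⟩ := (Nat.dvd_prime_pow Nat.prime_two).1 hcard
  rcases m with _ | m
  · rw [pow_zero, Finset.card_eq_one] at hm
    obtain ⟨q, hq⟩ := hm
    have : q = P := by rw [hq, Finset.mem_singleton] at hPO; exact hPO.symm
    rw [hq, Finset.prod_singleton, this] at hc
    rw [hc]
    exact (irreducible_mul_isUnit (hcu.map Polynomial.C)).2 hP
  · exfalso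
    refine hlead cc (P.leadingCoeff ^ (2 ^ m)) hcu ?_
    rw [hl, hm, ← pow_mul, pow_succ]

/-- Generalized Moore determinant. -/
noncomputable def mo (K : Type*) [Field K] (n : ℕ) (e : Fin n → ℕ) : MvPolynomial (Fin n) K :=
  Matrix.det (Matrix.of fun i j : Fin n => (X j : MvPolynomial (Fin n) K) ^ 2 ^ (e i))

noncomputable def mD (K : Type*) [Field K] (n : ℕ) : MvPolynomial (Fin n) K :=
  mo K n (fun i => (i : ℕ))

noncomputable def mN (K : Type*) [Field K] (n : ℕ) : MvPolynomial (Fin n) K :=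
  mo K n (fun i => if (i : ℕ) = 0 then 0 else (i : ℕ) + 1)

variable {K : Type*} [Field K] [Algebra (ZMod 2) K] [CharP K 2]

/-- The `F_2`-linear combinations of the variables. -/
noncomputable def ww (K : Type*) [Field K] [Algebra (ZMod 2) K] (n : ℕ) :
    (Fin n → ZMod 2) →+ MvPolynomial (Fin n) K where
  toFun v := ∑ j, C (algebraMap (ZMod 2) K (v j)) * X j
  map_zero' := by simp
  map_add' v u := by simp [add_mul, Finset.sum_add_distrib]

theorem ww_inj (n : ℕ) : Function.Injective (ww K n) := by
  classical
  intro v u h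
  funext i
  have h1 := congrArg (fun p => aeval (fun j => if j = i then (1 : K) else 0) p) h
  simp [ww] at h1
  exact h1

theorem mo_succ (n : ℕ) (e : Fin n → ℕ) : mo K n (fun i => e i + 1) = (mo K n e) ^ 2 := by
  have h := RingHom.map_det (frobenius (MvPolynomial (Fin n) K) 2)
    (Matrix.of fun i j : Fin n => (X j : MvPolynomial (Fin n) K) ^ 2 ^ (e i))
  rw [frobenius_def] at h
  rw [mo, mo, h]
  congr 1
  ext1 i j
  simp [frobenius_def, pow_succ, pow_mul]

theorem mo_fse (n : ℕ) (e : Fin (n + 1) → ℕ) :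
    finSuccEquiv K n (mo K (n + 1) e) =
      ∑ i, Polynomial.C (mo K n (e ∘ i.succAbove)) * Polynomial.X ^ 2 ^ (e i) := by
  rw [mo, Matrix.det_succ_column_zero, map_sum]
  refine Finset.sum_congr rfl fun i _ => ?_
  have h1 : (-1 : MvPolynomial (Fin (n + 1)) K) = 1 := by
    rw [CharTwo.neg_eq]
  have h2 : ((Matrix.of fun i j : Fin (n + 1) => (X j : MvPolynomial (Fin (n + 1)) K) ^ 2 ^ (e i)).submatrix
      i.succAbove Fin.succ).det = (finSuccEquiv K n).symm (Polynomial.C (mo K n (e ∘ i.succAbove))) := by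
    rw [AlgEquiv.eq_symm_apply, mo]
    have h3 := RingHom.map_det (finSuccEquiv K n).toRingEquiv.toRingHom ((Matrix.of fun i j : Fin (n + 1) => (X j : MvPolynomial (Fin (n + 1)) K) ^ 2 ^ (e i)).submatrix
      i.succAbove Fin.succ)
    rw [RingHom.map_det (Polynomial.C)]
    refine h3.trans ?_
    congr 1
    ext1 a b
    simp [finSuccEquiv_X_succ]
  rw [h2, h1, one_pow, one_mul, map_mul, AlgEquiv.apply_symm_apply, mul_comm]
  simp [finSuccEquiv_X_zero]

theorem mo_eval (n : ℕ) (e : Fin (n + 1) → ℕ) (v : Fin n → ZMod 2) :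
    (finSuccEquiv K n (mo K (n + 1) e)).eval (ww K n v) = 0 := by
  have hX : ∀ j : Fin n, (finSuccEquiv K n (mo K (n + 1) e)).eval (X j) = 0 := by
    intro j
    rw [mo]
    have h3 := RingHom.map_det ((Polynomial.evalRingHom (X j : MvPolynomial (Fin n) K)).comp (finSuccEquiv K n : _ →+* _))
      (Matrix.of fun i j : Fin (n + 1) => (X j : MvPolynomial (Fin (n + 1)) K) ^ 2 ^ (e i))
    refine h3.trans ?_
    refine Matrix.det_zero_of_column_eq (i := 0) (j := j.succ) (Fin.succ_ne_zero j).symm ?_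
    intro i
    simp [finSuccEquiv_X_zero, finSuccEquiv_X_succ]
  have h : ∀ t, (finSuccEquiv K n (mo K (n + 1) e)).eval t =
      ∑ i, mo K n (e ∘ i.succAbove) * t ^ 2 ^ (e i) := by
    intro t
    rw [mo_fse, Polynomial.eval_finsetSum]
    simp
  have hz : ∀ (z : ZMod 2) (m : ℕ), z ^ 2 ^ m = z := fun z m => ZMod.pow_card_pow z
  rw [h]
  have h4 : ∀ i, mo K n (e ∘ i.succAbove) * (ww K n v) ^ 2 ^ (e i) =
      ∑ j, C (algebraMap (ZMod 2) K (v j)) * (mo K n (e ∘ i.succAbove) * X j ^ 2 ^ (e i)) := by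
    intro i
    change mo K n (e ∘ i.succAbove) * (∑ j, C (algebraMap (ZMod 2) K (v j)) * X j) ^ 2 ^ (e i) = _
    rw [sum_pow_char_pow, Finset.mul_sum]
    refine Finset.sum_congr rfl fun j _ => ?_
    rw [mul_pow, ← map_pow, ← map_pow, hz]
    ring
  rw [Finset.sum_congr rfl fun i _ => h4 i, Finset.sum_comm]
  refine Finset.sum_eq_zero fun j _ => ?_
  rw [← Finset.mul_sum, ← h, hX, mul_zero]

theorem mo_taylor (n : ℕ) (e : Fin (n + 1) → ℕ) (v : Fin n → ZMod 2) :
    Polynomial.taylor (ww K n v) (finSuccEquiv K n (mo K (n + 1) e)) =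
      finSuccEquiv K n (mo K (n + 1) e) := by
  have h1 : Polynomial.taylor (ww K n v) (finSuccEquiv K n (mo K (n + 1) e)) =
      finSuccEquiv K n (mo K (n + 1) e) +
        Polynomial.C ((finSuccEquiv K n (mo K (n + 1) e)).eval (ww K n v)) := by
    rw [mo_fse, Polynomial.eval_finsetSum, map_sum, map_sum, ← Finset.sum_add_distrib]
    refine Finset.sum_congr rfl fun i _ => ?_
    rw [Polynomial.taylor_mul, Polynomial.taylor_C, Polynomial.taylor_X_pow, add_pow_char_pow]
    simp [mul_add]
  rw [h1, mo_eval, map_zero, add_zero]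

theorem mo_coeff_zero (n : ℕ) (e : Fin (n + 1) → ℕ) :
    (finSuccEquiv K n (mo K (n + 1) e)).coeff 0 = 0 := by
  rw [mo_fse, Polynomial.finsetSum_coeff]
  refine Finset.sum_eq_zero fun i _ => ?_
  rw [Polynomial.coeff_C_mul_X_pow, if_neg (pow_ne_zero _ two_ne_zero).symm]

theorem mo_coeff (n : ℕ) (e : Fin (n + 1) → ℕ) (he : Function.Injective e) (i : Fin (n + 1)) :
    (finSuccEquiv K n (mo K (n + 1) e)).coeff (2 ^ e i) = mo K n (e ∘ i.succAbove) := by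
  rw [mo_fse, Polynomial.finsetSum_coeff, Finset.sum_eq_single i]
  · rw [Polynomial.coeff_C_mul_X_pow, if_pos rfl]
  · intro j _ hj
    rw [Polynomial.coeff_C_mul_X_pow, if_neg]
    intro h
    exact hj (he (Nat.pow_right_injective le_rfl h)).symm
  · simp

theorem mo_deg (n : ℕ) (e : Fin (n + 1) → ℕ) (m : ℕ) (he : ∀ i, e i ≤ m) :
    (finSuccEquiv K n (mo K (n + 1) e)).natDegree ≤ 2 ^ m := by
  rw [mo_fse]
  refine Polynomial.natDegree_sum_le_of_forall_le _ _ fun i _ => ?_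
  exact (Polynomial.natDegree_C_mul_X_pow_le _ _).trans (Nat.pow_le_pow_right (by norm_num) (he i))

theorem mD_inj (n : ℕ) : Function.Injective (fun i : Fin n => (i : ℕ)) := Fin.val_injective

theorem mN_inj (n : ℕ) :
    Function.Injective (fun i : Fin n => if (i : ℕ) = 0 then 0 else (i : ℕ) + 1) := by
  intro i j h
  ext
  simp only at h
  split_ifs at h <;> omega

theorem mD_top (n : ℕ) : (finSuccEquiv K n (mD K (n + 1))).coeff (2 ^ n) = mD K n := by
  have h := mo_coeff (K := K) n _ (mD_inj (n + 1)) (Fin.last n)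
  rw [Fin.val_last] at h
  rw [mD, h, mD]
  congr 1
  funext a
  simp

theorem mD_one (n : ℕ) : (finSuccEquiv K n (mD K (n + 1))).coeff 1 = mD K n ^ 2 := by
  have h := mo_coeff (K := K) n _ (mD_inj (n + 1)) 0
  rw [Fin.val_zero, pow_zero] at h
  rw [mD, h, mD, ← mo_succ]
  congr 1

theorem mN_one (n : ℕ) : (finSuccEquiv K n (mN K (n + 1))).coeff 1 = mD K n ^ 4 := by
  have h := mo_coeff (K := K) n _ (mN_inj (n + 1)) 0
  rw [Fin.val_zero, if_pos rfl, pow_zero] at h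
  rw [mN, h, mD, show 4 = 2 * 2 from rfl, pow_mul, ← mo_succ, ← mo_succ]
  congr 1

theorem mN_top (n : ℕ) (hn : 1 ≤ n) :
    (finSuccEquiv K n (mN K (n + 1))).coeff (2 ^ (n + 1)) = mN K n := by
  have h := mo_coeff (K := K) n _ (mN_inj (n + 1)) (Fin.last n)
  rw [Fin.val_last, if_neg (by omega)] at h
  rw [mN, h, mN]
  congr 1
  funext a
  simp only [Function.comp_apply, Fin.succAbove_last, Fin.val_castSucc]

theorem mD_ne (n : ℕ) : mD K n ≠ 0 := by
  induction n with
  | zero => simp [mD, mo]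
  | succ n ih =>
    intro h
    have := mD_top (K := K) n
    rw [h] at this
    simp at this
    exact ih this.symm

theorem mN_ne (n : ℕ) : mN K n ≠ 0 := by
  cases n with
  | zero => simp [mN, mo]
  | succ n =>
    intro h
    have := mN_one (K := K) n
    rw [h] at this
    simp at this
    exact pow_ne_zero 4 (mD_ne (K := K) n) this.symm

theorem mD_natDegree (n : ℕ) : (finSuccEquiv K n (mD K (n + 1))).natDegree = 2 ^ n := by
  refine le_antisymm (mo_deg _ _ _ fun i => by omega) (Polynomial.le_natDegree_of_ne_zero ?_)
  rw [mD_top]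
  exact mD_ne n

theorem mN_natDegree (n : ℕ) (hn : 1 ≤ n) :
    (finSuccEquiv K n (mN K (n + 1))).natDegree = 2 ^ (n + 1) := by
  refine le_antisymm (mo_deg _ _ _ fun i => ?_) (Polynomial.le_natDegree_of_ne_zero ?_)
  · split_ifs <;> omega
  · rw [mN_top n hn]
    exact mN_ne n

theorem step (n : ℕ) (hn : 1 ≤ n) (F : MvPolynomial (Fin (n + 1)) K)
    (hF : mD K (n + 1) * F = mN K (n + 1)) :
    (finSuccEquiv K n F).natDegree = 2 ^ n ∧
    mD K n * (finSuccEquiv K n F).leadingCoeff = mN K n ∧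
    (∀ v, Polynomial.taylor (ww K n v) (finSuccEquiv K n F) = finSuccEquiv K n F) ∧
    (finSuccEquiv K n F).coeff 0 = mD K n ^ 2 ∧
    finSuccEquiv K n F * Polynomial.C (mD K n) =
      Polynomial.C (finSuccEquiv K n F).leadingCoeff * finSuccEquiv K n (mD K (n + 1)) +
        Polynomial.C (mD K n ^ 3) := by
  have hF0 : F ≠ 0 := by
    rintro rfl
    exact mN_ne (K := K) (n + 1) (by rw [← hF, mul_zero])
  have hG := congrArg (finSuccEquiv K n) hF
  rw [map_mul] at hG
  set G := finSuccEquiv K n F with hGdef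
  have hG0 : G ≠ 0 := by simpa [hGdef] using hF0
  have hDp0 : finSuccEquiv K n (mD K (n + 1)) ≠ 0 := by
    simpa using mD_ne (K := K) (n + 1)
  have hdeg : G.natDegree = 2 ^ n := by
    have h := Polynomial.natDegree_mul hDp0 hG0
    rw [hG, mN_natDegree n hn, mD_natDegree, pow_succ] at h
    omega
  have hDl : (finSuccEquiv K n (mD K (n + 1))).leadingCoeff = mD K n := by
    rw [Polynomial.leadingCoeff, mD_natDegree, mD_top]
  have hlead : mD K n * G.leadingCoeff = mN K n := by
    have h := Polynomial.leadingCoeff_mul (finSuccEquiv K n (mD K (n + 1))) G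
    rw [hG, hDl, Polynomial.leadingCoeff, mN_natDegree n hn, mN_top n hn] at h
    exact h.symm
  have hinv : ∀ v, Polynomial.taylor (ww K n v) G = G := by
    intro v
    have h := congrArg (Polynomial.taylor (ww K n v)) hG
    rw [Polynomial.taylor_mul, mD, mN, mo_taylor, mo_taylor] at h
    rw [mD, mN] at hG
    rw [mD] at hDp0
    exact mul_left_cancel₀ hDp0 (h.trans hG.symm)
  have hc0 : G.coeff 0 = mD K n ^ 2 := by
    have h := congrArg (fun p => Polynomial.coeff p 1) hG
    simp only [Polynomial.mul_coeff_one] at h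
    rw [mD_one, mN_one] at h
    rw [mD, mo_coeff_zero, zero_mul, zero_add] at h
    exact mul_left_cancel₀ (pow_ne_zero 2 (mD_ne (K := K) n)) (h.trans (by ring))
  refine ⟨hdeg, hlead, hinv, hc0, ?_⟩
  set E := G * Polynomial.C (mD K n) -
    Polynomial.C G.leadingCoeff * finSuccEquiv K n (mD K (n + 1)) with hE
  have hEinv : ∀ v, Polynomial.taylor (ww K n v) E = E := by
    intro v
    rw [hE, map_sub, Polynomial.taylor_mul, Polynomial.taylor_mul, hinv, Polynomial.taylor_C,
      Polynomial.taylor_C, mD, mD, mo_taylor]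
  have hEd : E.natDegree < Fintype.card (Fin n → ZMod 2) := by
    have hcd : Fintype.card (Fin n → ZMod 2) = 2 ^ n := by simp
    rw [hcd]
    have hle : E.natDegree ≤ 2 ^ n := by
      refine (Polynomial.natDegree_sub_le _ _).trans (max_le ?_ ?_)
      · exact (Polynomial.natDegree_mul_C_le _ _).trans hdeg.le
      · exact (Polynomial.natDegree_C_mul_le _ _).trans (mD_natDegree n).le
    refine lt_of_le_of_ne hle fun heq => ?_
    have h0 : E.coeff (2 ^ n) = 0 := by
      rw [hE, Polynomial.coeff_sub, Polynomial.coeff_mul_C, Polynomial.coeff_C_mul, mD_top,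
        Polynomial.leadingCoeff, hdeg, sub_self]
    rw [← heq] at h0
    have : E = 0 := Polynomial.leadingCoeff_eq_zero.1 h0
    rw [this, Polynomial.natDegree_zero] at heq
    exact (pow_ne_zero n two_ne_zero) heq.symm
  have hEc := inv_const (ww K n) (ww_inj n) E hEinv hEd
  have hE0 : E.coeff 0 = mD K n ^ 3 := by
    rw [hE, Polynomial.coeff_sub, Polynomial.coeff_mul_C, Polynomial.coeff_C_mul, hc0]
    rw [show (finSuccEquiv K n (mD K (n + 1))).coeff 0 = 0 from mo_coeff_zero _ _]
    ring
  rw [hE0] at hEc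
  rw [← hEc, hE]
  ring

theorem cop (n : ℕ) (hn : 1 ≤ n) : ∀ F : MvPolynomial (Fin n) K, mD K n * F = mN K n →
    ∀ p : MvPolynomial (Fin n) K, Prime p → p ∣ mD K n → p ∣ F → False := by
  induction n, hn using Nat.le_induction with
  | base =>
    intro F hF p hp _ hpF
    have h1 : mN K 1 = mD K 1 := by
      rw [mN, mD]
      congr 1
      funext i
      have : (i : ℕ) = 0 := by omega
      simp [this]
    have h2 : F = 1 := mul_left_cancel₀ (mD_ne (K := K) 1) (by rw [hF, h1, mul_one])
    rw [h2] at hpF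
    exact hp.not_isUnit (isUnit_of_dvd_one hpF)
  | succ n hn ih =>
    intro F hF p hp hpD hpF
    obtain ⟨hdeg, hlead, hinv, hc0, hrel⟩ := step n hn F hF
    have hP : Prime (finSuccEquiv K n p) := (MulEquiv.prime_iff (finSuccEquiv K n)).2 hp
    have hPD := map_dvd (finSuccEquiv K n) hpD
    have hPF := map_dvd (finSuccEquiv K n) hpF
    have h3 : finSuccEquiv K n p ∣ Polynomial.C (mD K n ^ 3) := by
      refine (dvd_add_right (dvd_mul_of_dvd_right hPD
        (Polynomial.C (finSuccEquiv K n F).leadingCoeff))).1 ?_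
      rw [← hrel]
      exact dvd_mul_of_dvd_left hPF _
    rw [map_pow] at h3
    have h4 := hP.dvd_of_dvd_pow h3
    have h5 : (finSuccEquiv K n p).natDegree = 0 := by
      have h := Polynomial.natDegree_le_of_dvd h4 (by simpa using mD_ne (K := K) n)
      rw [Polynomial.natDegree_C] at h
      omega
    rw [Polynomial.eq_C_of_natDegree_eq_zero h5] at hP hPF h4
    refine ih _ hlead _ (Polynomial.prime_C_iff.1 hP) ?_ (Polynomial.C_dvd_iff_dvd_coeff _ _ |>.1 hPF _)
    have := (Polynomial.C_dvd_iff_dvd_coeff _ _).1 h4 0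
    rwa [Polynomial.coeff_C_zero] at this

theorem not_sq (n : ℕ) (hn : 1 ≤ n) (F : MvPolynomial (Fin (n + 1)) K)
    (hF : mD K (n + 1) * F = mN K (n + 1)) (c a : MvPolynomial (Fin (n + 1)) K) (hc : IsUnit c) :
    F ≠ a ^ 2 * c := by
  intro h
  obtain ⟨hdeg, hlead, hinv, hc0, hrel⟩ := step n hn F hF
  have h1 := congrArg (fun p => Polynomial.coeff p 1) hrel
  simp only [Polynomial.coeff_add, Polynomial.coeff_mul_C, Polynomial.coeff_C_mul, mD_one,
    Polynomial.coeff_C_succ, add_zero] at h1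
  have hcu : IsUnit (finSuccEquiv K n c) := hc.map _
  obtain ⟨d, -, hd⟩ := Polynomial.isUnit_iff.1 hcu
  have h2 : (finSuccEquiv K n F).coeff 1 = 0 := by
    rw [h, map_mul, ← hd, Polynomial.coeff_mul_C, map_pow, sq, Polynomial.mul_coeff_one, mul_comm,
      mul_comm (Polynomial.coeff _ 1), CharTwo.add_self_eq_zero, mul_zero]
  rw [h2, zero_mul] at h1
  have h3 : (finSuccEquiv K n F).leadingCoeff ≠ 0 := by
    intro h0
    rw [h0, mul_zero] at hlead
    exact mN_ne (K := K) n hlead.symm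
  exact (mul_ne_zero h3 (pow_ne_zero 2 (mD_ne (K := K) n))) h1.symm

theorem main_irr (n : ℕ) (hn : 1 ≤ n) (F : MvPolynomial (Fin (n + 1 + 1)) K)
    (hF : mD K (n + 1 + 1) * F = mN K (n + 1 + 1)) : Irreducible F := by
  obtain ⟨hdeg, hlead, hinv, hc0, hrel⟩ := step (n + 1) (by omega) F hF
  rw [← MulEquiv.irreducible_iff (finSuccEquiv K (n + 1))]
  refine irr_abstract (ww K (n + 1)) (ww_inj _) (n + 1) (by simp) _ hdeg hinv ?_ ?_
  · intro p hp hpF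
    have h := (Polynomial.C_dvd_iff_dvd_coeff _ _).1 hpF
    refine cop (n + 1) (by omega) _ hlead p hp ?_ (h _)
    have h0 := h 0
    rw [hc0] at h0
    exact hp.dvd_of_dvd_pow h0
  · intro c a hc
    exact not_sq n hn _ hlead c a hc

end FkAux

/-- For `k ≥ 3`, the polynomial `Fk = Δ_1(X_1,…,X_k)/Δ(X_1,…,X_k)` (characterized by
`Δ · Fk = Δ_1`) is absolutely irreducible: it is irreducible over the algebraic closure
of `F_2`. -/
theorem Fk_absolutely_irreducible (k : ℕ) (hk : 3 ≤ k)
    (Fk : MvPolynomial (Fin k) (ZMod 2))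
    (hFk : Matrix.det (Matrix.of fun i j : Fin k =>
          (X j : MvPolynomial (Fin k) (ZMod 2)) ^ 2 ^ (i : ℕ)) * Fk =
        Matrix.det (Matrix.of fun i j : Fin k =>
          (X j : MvPolynomial (Fin k) (ZMod 2)) ^
            2 ^ (if (i : ℕ) = 0 then 0 else (i : ℕ) + 1))) :
    Irreducible (MvPolynomial.map (algebraMap (ZMod 2) (AlgebraicClosure (ZMod 2))) Fk) := by
  obtain ⟨n, rfl⟩ : ∃ n, k = n + 1 + 1 := ⟨k - 2, by omega⟩
  have hch : CharP (AlgebraicClosure (ZMod 2)) 2 :=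
    charP_of_injective_algebraMap (algebraMap (ZMod 2) (AlgebraicClosure (ZMod 2))).injective 2
  refine main_irr n (by omega) _ ?_
  have hm : ∀ e : Fin (n + 1 + 1) → ℕ,
      MvPolynomial.map (algebraMap (ZMod 2) (AlgebraicClosure (ZMod 2)))
        (mo (ZMod 2) (n + 1 + 1) e) = mo (AlgebraicClosure (ZMod 2)) (n + 1 + 1) e := by
    intro e
    rw [mo, mo, RingHom.map_det]
    congr 1
    ext1 i j
    simp
  have h := congrArg (MvPolynomial.map (algebraMap (ZMod 2) (AlgebraicClosure (ZMod 2)))) hFk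
  rw [map_mul] at h
  rw [mD, mN, ← hm, ← hm]
  exact h
end
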